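/- arXiv:cs/0611146 — 2 statements merged into one kernel-verified Lean document; each statement's English description precedes it below -/
import Mathlib

section
/- Let F: X^n → Y^m be a random linear code, Σ_n, Σ_m independent uniform random permutations, and Ȳ^m an independent uniform random vector on Y^m. Define F̂(x) = Σ_m(F(Σ_n(x))) + Ȳ^m. Then (i) Pr{F̂(x) = y} = |Y|^{-m} for all x, y, and (ii) for any x ≠ x̂ in X^n and any y, ŷ in Y^m, Pr{F̂(x̂) = ŷ | F̂(x) = y} = |Y|^{-m} · α(F)(P_{x̂ - x}, P_{ŷ - y}). -/
open Finset Filter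

open scoped Classical

noncomputable def empDist {X : Type*} [Fintype X] {n : ℕ} (x : Fin n → X) : X → ℝ :=
  fun a => ((univ.filter fun i => x i = a).card : ℝ) / n

noncomputable def specS {X : Type*} [Fintype X] {n : ℕ}
    (A : Finset (Fin n → X)) (P : X → ℝ) : ℝ :=
  ((A.filter fun x => empDist x = P).card : ℝ) / (A.card : ℝ)

noncomputable def jointSpec {X Y : Type*} [Fintype X] [Fintype Y] {n m : ℕ}
    (f : (Fin n → X) → (Fin m → Y)) (P : X → ℝ) (Q : Y → ℝ) : ℝ :=
  ((univ.filter fun x : Fin n → X => empDist x = P ∧ empDist (f x) = Q).card : ℝ) /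
    ((Fintype.card X : ℝ) ^ n)

noncomputable def fullJointSpec (X Y : Type*) [Fintype X] [Fintype Y] (n m : ℕ)
    (P : X → ℝ) (Q : Y → ℝ) : ℝ :=
  specS (univ : Finset (Fin n → X)) P * specS (univ : Finset (Fin m → Y)) Q

noncomputable def alphaE {X Y : Type*} [Fintype X] [Fintype Y] {n m : ℕ} {Ω : Type*}
    [Fintype Ω] (μ : Ω → ℝ) (F : Ω → (Fin n → X) → (Fin m → Y))
    (P : X → ℝ) (Q : Y → ℝ) : ℝ :=
  (∑ ω, μ ω * jointSpec (F ω) P Q) / fullJointSpec X Y n m P Q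

def permAct {X : Type*} {n : ℕ} (σ : Equiv.Perm (Fin n)) (x : Fin n → X) : Fin n → X :=
  fun i => x (σ.symm i)

noncomputable def entH {X : Type*} [Fintype X] (P : X → ℝ) : ℝ :=
  ∑ a, -(P a * Real.log (P a))

noncomputable def binEnt (x : ℝ) : ℝ := -(x * Real.log x) - (1 - x) * Real.log (1 - x)

noncomputable def prHat {X Y : Type*} [Fintype X] [Fintype Y] [AddCommGroup X]
    [AddCommGroup Y] {n m : ℕ} {Ω : Type*} [Fintype Ω] (μ : Ω → ℝ)
    (F : Ω → ((Fin n → X) →+ (Fin m → Y))) (x : Fin n → X) (y : Fin m → Y) : ℝ :=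
  ∑ ω, ∑ σ : Equiv.Perm (Fin n), ∑ τ : Equiv.Perm (Fin m), ∑ b : Fin m → Y,
    μ ω / ((Fintype.card (Equiv.Perm (Fin n)) : ℝ) * (Fintype.card (Equiv.Perm (Fin m)) : ℝ) *
        (Fintype.card (Fin m → Y) : ℝ)) *
      (if permAct τ (F ω (permAct σ x)) + b = y then 1 else 0)

noncomputable def prHat2 {X Y : Type*} [Fintype X] [Fintype Y] [AddCommGroup X]
    [AddCommGroup Y] {n m : ℕ} {Ω : Type*} [Fintype Ω] (μ : Ω → ℝ)
    (F : Ω → ((Fin n → X) →+ (Fin m → Y))) (x x' : Fin n → X) (y y' : Fin m → Y) : ℝ :=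
  ∑ ω, ∑ σ : Equiv.Perm (Fin n), ∑ τ : Equiv.Perm (Fin m), ∑ b : Fin m → Y,
    μ ω / ((Fintype.card (Equiv.Perm (Fin n)) : ℝ) * (Fintype.card (Equiv.Perm (Fin m)) : ℝ) *
        (Fintype.card (Fin m → Y) : ℝ)) *
      (if permAct τ (F ω (permAct σ x)) + b = y ∧ permAct τ (F ω (permAct σ x')) + b = y'
        then 1 else 0)

theorem permAct_mul {X : Type*} {n : ℕ} (σ ρ : Equiv.Perm (Fin n)) (x : Fin n → X) :
    permAct (σ * ρ) x = permAct σ (permAct ρ x) := rfl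

theorem permAct_one {X : Type*} {n : ℕ} (x : Fin n → X) : permAct 1 x = x := rfl

theorem permAct_sub {X : Type*} [AddCommGroup X] {n : ℕ} (σ : Equiv.Perm (Fin n))
    (x z : Fin n → X) : permAct σ (x - z) = permAct σ x - permAct σ z := rfl

theorem permAct_eq_iff {X : Type*} {n : ℕ} (σ : Equiv.Perm (Fin n)) (x z : Fin n → X) :
    permAct σ x = z ↔ permAct σ⁻¹ z = x := by
  constructor <;> rintro rfl
  · rw [← permAct_mul, inv_mul_cancel, permAct_one]
  · rw [← permAct_mul, mul_inv_cancel, permAct_one]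

theorem empDist_permAct {X : Type*} [Fintype X] {n : ℕ} (σ : Equiv.Perm (Fin n))
    (x : Fin n → X) : empDist (permAct σ x) = empDist x := by
  funext a
  unfold empDist permAct
  congr 2
  refine Finset.card_bij (fun i _ => σ.symm i) ?_ ?_ ?_
  · simp
  · simp
  · intro b hb
    exact ⟨σ b, by simpa using hb, by simp⟩

theorem exists_permAct_eq {X : Type*} [Fintype X] {n : ℕ} {x z : Fin n → X}
    (h : empDist z = empDist x) : ∃ σ, permAct σ x = z := by
  rcases Nat.eq_zero_or_pos n with rfl | hn
  · exact ⟨1, Subsingleton.elim _ _⟩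
  have hcard (a : X) : Fintype.card {i // z i = a} = Fintype.card {i // x i = a} := by
    have ha := congrFun h a
    unfold empDist at ha
    rw [div_left_inj' (by positivity)] at ha
    rw [Fintype.card_subtype, Fintype.card_subtype]
    exact_mod_cast ha
  let e := Equiv.ofFiberEquiv fun a => Fintype.equivOfCardEq (hcard a)
  exact ⟨e.symm, funext fun i => Equiv.ofFiberEquiv_map _ i⟩

/-- Averaging over the orbit of `d` under permutations is averaging over its type class. -/
theorem card_mul_sum_permAct {X : Type*} [Fintype X] {n : ℕ} (d : Fin n → X)
    (g : (Fin n → X) → ℝ) :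
    ((univ.filter fun z : Fin n → X => empDist z = empDist d).card : ℝ) *
        ∑ σ : Equiv.Perm (Fin n), g (permAct σ d) =
      (Fintype.card (Equiv.Perm (Fin n)) : ℝ) *
        ∑ z ∈ univ.filter (fun z : Fin n → X => empDist z = empDist d), g z := by
  have horbit : ∀ z ∈ univ.filter (fun z : Fin n → X => empDist z = empDist d),
      ∑ σ : Equiv.Perm (Fin n), g (permAct σ z) = ∑ σ : Equiv.Perm (Fin n), g (permAct σ d) := by
    intro z hz
    obtain ⟨ρ, rfl⟩ := exists_permAct_eq (mem_filter.1 hz).2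
    exact Fintype.sum_equiv (Equiv.mulRight ρ) _ _ fun σ => rfl
  have hclass (σ : Equiv.Perm (Fin n)) :
      ∑ z ∈ univ.filter (fun z : Fin n → X => empDist z = empDist d), g (permAct σ z) =
        ∑ z ∈ univ.filter (fun z : Fin n → X => empDist z = empDist d), g z := by
    refine Finset.sum_bij' (fun z _ => permAct σ z) (fun z _ => permAct σ⁻¹ z) ?_ ?_ ?_ ?_ ?_
    · simp [empDist_permAct]
    · simp [empDist_permAct]
    · exact fun z _ => (permAct_eq_iff σ z _).1 rfl
    · exact fun z _ => (permAct_eq_iff σ _ z).2 rfl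
    · exact fun _ _ => rfl
  rw [← nsmul_eq_mul, ← Finset.sum_const, ← Finset.sum_congr rfl horbit, Finset.sum_comm,
    Finset.sum_congr rfl fun σ _ => hclass σ, Finset.sum_const, nsmul_eq_mul, Finset.card_univ]

theorem card_mul_sum_indicator_permAct_eq {Y : Type*} [Fintype Y] {m : ℕ} (v e : Fin m → Y) :
    ((univ.filter fun z : Fin m → Y => empDist z = empDist e).card : ℝ) *
        ∑ τ : Equiv.Perm (Fin m), (if permAct τ v = e then (1 : ℝ) else 0) =
      (Fintype.card (Equiv.Perm (Fin m)) : ℝ) *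
        (if empDist v = empDist e then 1 else 0) := by
  have hinv : ∑ τ : Equiv.Perm (Fin m), (if permAct τ v = e then (1 : ℝ) else 0) =
      ∑ τ : Equiv.Perm (Fin m), (if permAct τ e = v then (1 : ℝ) else 0) :=
    Fintype.sum_equiv (Equiv.inv _) _ _ fun τ => if_congr (permAct_eq_iff τ v e) rfl rfl
  rw [hinv, card_mul_sum_permAct e fun z => if z = v then 1 else 0, Finset.sum_ite_eq']
  simp

theorem sum_indicator_permAct_comp {X Y : Type*} [Fintype X] [Fintype Y] {n m : ℕ}
    (f : (Fin n → X) → (Fin m → Y)) (d : Fin n → X) (e : Fin m → Y) :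
    ∑ σ : Equiv.Perm (Fin n), ∑ τ : Equiv.Perm (Fin m),
        (if permAct τ (f (permAct σ d)) = e then (1 : ℝ) else 0) =
      (Fintype.card (Equiv.Perm (Fin n)) : ℝ) * (Fintype.card (Equiv.Perm (Fin m)) : ℝ) *
        ((univ.filter fun z : Fin n → X =>
            empDist z = empDist d ∧ empDist (f z) = empDist e).card : ℝ) /
          (((univ.filter fun z : Fin n → X => empDist z = empDist d).card : ℝ) *
            ((univ.filter fun z : Fin m → Y => empDist z = empDist e).card : ℝ)) := by
  have hd : ((univ.filter fun z : Fin n → X => empDist z = empDist d).card : ℝ) ≠ 0 :=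
    Nat.cast_ne_zero.2 (Finset.card_ne_zero_of_mem (a := d) (by simp))
  have he : ((univ.filter fun z : Fin m → Y => empDist z = empDist e).card : ℝ) ≠ 0 :=
    Nat.cast_ne_zero.2 (Finset.card_ne_zero_of_mem (a := e) (by simp))
  rw [eq_div_iff (mul_ne_zero hd he)]
  have hσ := card_mul_sum_permAct d fun z =>
    ∑ τ : Equiv.Perm (Fin m), (if permAct τ (f z) = e then (1 : ℝ) else 0)
  rw [mul_comm, mul_comm (Finset.card _ : ℝ), mul_assoc, hσ, mul_left_comm, Finset.mul_sum,
    Finset.sum_congr rfl fun z _ => card_mul_sum_indicator_permAct_eq (f z) e,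
    ← Finset.mul_sum, Finset.sum_boole, Finset.filter_filter, mul_assoc]

theorem sum_indicator_add_eq {Y : Type*} [Fintype Y] [AddCommGroup Y] {m : ℕ}
    (u v y y' : Fin m → Y) :
    ∑ b : Fin m → Y, (if u + b = y ∧ v + b = y' then (1 : ℝ) else 0) =
      if v - u = y' - y then 1 else 0 := by
  have hiff (b : Fin m → Y) : (u + b = y ∧ v + b = y') ↔ (b = y - u ∧ v - u = y' - y) := by
    constructor
    · rintro ⟨rfl, rfl⟩
      constructor <;> abel
    · rintro ⟨rfl, h⟩
      refine ⟨by abel, ?_⟩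
      rw [show v + (y - u) = (v - u) + y by abel, h, sub_add_cancel]
  simp only [hiff, ite_and, Finset.sum_ite_eq', mem_univ, if_true]

theorem prHat_eq {X Y : Type*} [Fintype X] [Fintype Y] [AddCommGroup X] [AddCommGroup Y]
    {n m : ℕ} {Ω : Type*} [Fintype Ω] (μ : Ω → ℝ) (hμ : ∑ ω, μ ω = 1)
    (F : Ω → ((Fin n → X) →+ (Fin m → Y))) (x : Fin n → X) (y : Fin m → Y) :
    prHat μ F x y = ((Fintype.card Y : ℝ) ^ m)⁻¹ := by
  have hb (u : Fin m → Y) : ∑ b : Fin m → Y, (if u + b = y then (1 : ℝ) else 0) = 1 := by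
    simpa using sum_indicator_add_eq u u y y
  unfold prHat
  simp only [← Finset.mul_sum, hb, Finset.sum_const, Finset.card_univ, nsmul_eq_mul, mul_one]
  have hn : (Fintype.card (Equiv.Perm (Fin n)) : ℝ) ≠ 0 := Nat.cast_ne_zero.2 Fintype.card_ne_zero
  have hm : (Fintype.card (Equiv.Perm (Fin m)) : ℝ) ≠ 0 := Nat.cast_ne_zero.2 Fintype.card_ne_zero
  rw [← Finset.sum_div, hμ, Fintype.card_fun, Fintype.card_fin]
  push_cast
  field_simp

theorem prHat2_eq {X Y : Type*} [Fintype X] [Fintype Y] [AddCommGroup X] [AddCommGroup Y]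
    {n m : ℕ} {Ω : Type*} [Fintype Ω] (μ : Ω → ℝ)
    (F : Ω → ((Fin n → X) →+ (Fin m → Y))) (x x' : Fin n → X) (y y' : Fin m → Y) :
    prHat2 μ F x x' y y' = ((Fintype.card Y : ℝ) ^ m)⁻¹ * (((Fintype.card Y : ℝ) ^ m)⁻¹ *
      alphaE μ (fun ω => ⇑(F ω)) (empDist (x' - x)) (empDist (y' - y))) := by
  unfold prHat2 alphaE fullJointSpec specS jointSpec
  simp only [← Finset.mul_sum, sum_indicator_add_eq, ← permAct_sub, ← map_sub]
  have hn : (Fintype.card (Equiv.Perm (Fin n)) : ℝ) ≠ 0 := Nat.cast_ne_zero.2 Fintype.card_ne_zero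
  have hm : (Fintype.card (Equiv.Perm (Fin m)) : ℝ) ≠ 0 := Nat.cast_ne_zero.2 Fintype.card_ne_zero
  have hX : (Fintype.card X : ℝ) ≠ 0 := Nat.cast_ne_zero.2 Fintype.card_ne_zero
  have hY : (Fintype.card Y : ℝ) ≠ 0 := Nat.cast_ne_zero.2 Fintype.card_ne_zero
  rw [Finset.sum_div, Finset.mul_sum, Finset.mul_sum]
  refine Finset.sum_congr rfl fun ω _ => ?_
  rw [sum_indicator_permAct_comp (F ω) (x' - x) (y' - y)]
  simp only [Finset.card_univ, Fintype.card_fun, Fintype.card_fin, Nat.cast_pow]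
  have hd : ((univ.filter fun z : Fin n → X => empDist z = empDist (x' - x)).card : ℝ) ≠ 0 :=
    Nat.cast_ne_zero.2 (Finset.card_ne_zero_of_mem (a := x' - x) (by simp))
  have he : ((univ.filter fun z : Fin m → Y => empDist z = empDist (y' - y)).card : ℝ) ≠ 0 :=
    Nat.cast_ne_zero.2 (Finset.card_ne_zero_of_mem (a := y' - y) (by simp))
  field_simp

theorem stmt8 {X Y : Type*} [Fintype X] [Fintype Y] [AddCommGroup X] [AddCommGroup Y]
    {n m : ℕ} {Ω : Type*} [Fintype Ω] (μ : Ω → ℝ)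
    (hμ0 : ∀ ω, 0 ≤ μ ω) (hμ1 : ∑ ω, μ ω = 1)
    (F : Ω → ((Fin n → X) →+ (Fin m → Y)))
    (x x' : Fin n → X) (hxx : x ≠ x') (y y' : Fin m → Y) :
    prHat μ F x y = ((Fintype.card Y : ℝ) ^ m)⁻¹ ∧
      prHat2 μ F x x' y y' / prHat μ F x y
        = ((Fintype.card Y : ℝ) ^ m)⁻¹ *
            alphaE μ (fun ω => ⇑(F ω)) (empDist (x' - x)) (empDist (y' - y)) := by
  have hY : (Fintype.card Y : ℝ) ≠ 0 := Nat.cast_ne_zero.2 Fintype.card_ne_zero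
  refine ⟨prHat_eq μ hμ1 F x y, ?_⟩
  rw [prHat_eq μ hμ1, prHat2_eq, mul_div_cancel_left₀ _ (inv_ne_zero (pow_ne_zero m hY))]
end

section
/- (Distance property of asymptotically good linear codes) Let F = {F_n: X^n → Y^{m_n}} be a sequence of δ-asymptotically good random linear codes with finite sup-rate R̄ = limsup_n n/m_n. For any real numbers h_X, h_Y satisfying (h_X + δ)·R̄ + h_Y < ln|Y|, the expected number of pairs (x, F_n(x)) with x ≠ 0^n, H(P_x) ≤ h_X, and H(P_{F_n(x)}) ≤ h_Y tends to 0 as n → ∞. -/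
open Finset Filter

open scoped Classical

theorem card_eq_mul_empDist {X : Type*} [Fintype X] {n : ℕ} (x : Fin n → X) (a : X) :
    ((univ.filter fun i => x i = a).card : ℝ) = n * empDist x a := by
  unfold empDist
  rcases Nat.eq_zero_or_pos n with rfl | hn
  · simp
  · have : (n : ℝ) ≠ 0 := by positivity
    field_simp

theorem empDist_nonneg {X : Type*} [Fintype X] {n : ℕ} (x : Fin n → X) (a : X) :
    0 ≤ empDist x a := by
  unfold empDist; positivity

theorem empDist_apply_pos {X : Type*} [Fintype X] {n : ℕ} (x : Fin n → X) (i : Fin n) :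
    0 < empDist x (x i) := by
  unfold empDist
  have hn : 0 < n := i.pos
  have : 0 < (univ.filter fun j => x j = x i).card := card_pos.2 ⟨i, by simp⟩
  positivity

theorem empDist_le_one {X : Type*} [Fintype X] {n : ℕ} (x : Fin n → X) (a : X) :
    empDist x a ≤ 1 := by
  unfold empDist
  refine div_le_one_of_le₀ ?_ (by positivity)
  exact_mod_cast (card_le_univ _).trans_eq (by simp)

theorem sum_empDist_le_one {X : Type*} [Fintype X] {n : ℕ} (x : Fin n → X) :
    ∑ a, empDist x a ≤ 1 := by
  unfold empDist
  rw [← Finset.sum_div]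
  refine div_le_one_of_le₀ ?_ (by positivity)
  have h := card_eq_sum_card_fiberwise (s := (univ : Finset (Fin n))) (t := (univ : Finset X))
    (f := x) (fun _ _ => by simp)
  rw [card_univ, Fintype.card_fin] at h
  exact_mod_cast h.ge

theorem entH_empDist_nonneg {X : Type*} [Fintype X] {n : ℕ} (x : Fin n → X) :
    0 ≤ entH (empDist x) :=
  sum_nonneg fun a _ => neg_nonneg.2 <| mul_nonpos_of_nonneg_of_nonpos (empDist_nonneg x a)
    (Real.log_nonpos (empDist_nonneg x a) (empDist_le_one x a))

theorem prod_empDist_apply {X : Type*} [Fintype X] {n : ℕ} (x : Fin n → X) :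
    ∏ i, empDist x (x i) = Real.exp (-(n * entH (empDist x))) := by
  have h : ∑ i, Real.log (empDist x (x i)) = -(n * entH (empDist x)) := by
    rw [← sum_fiberwise (s := univ) (g := x)]
    unfold entH
    rw [mul_sum, ← sum_neg_distrib]
    refine sum_congr rfl fun a _ => ?_
    rw [sum_congr rfl (g := fun _ => Real.log (empDist x a))
      (fun i hi => by rw [(mem_filter.1 hi).2]), sum_const, nsmul_eq_mul, card_eq_mul_empDist]
    ring
  rw [← h, Real.exp_sum]
  exact prod_congr rfl fun i _ => (Real.exp_log (empDist_apply_pos x i)).symm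

/-- A type class has at most `exp (n H(P))` elements. -/
theorem card_typeClass_le {X : Type*} [Fintype X] {n : ℕ} (x : Fin n → X) :
    ((univ.filter fun z : Fin n → X => empDist z = empDist x).card : ℝ) ≤
      Real.exp (n * entH (empDist x)) := by
  have h : ((univ.filter fun z : Fin n → X => empDist z = empDist x).card : ℝ) *
      Real.exp (-(n * entH (empDist x))) ≤ 1 := by
    calc _ = ∑ z ∈ univ.filter (fun z : Fin n → X => empDist z = empDist x),
          ∏ i, empDist x (z i) := by
          rw [← nsmul_eq_mul, ← sum_const]
          refine sum_congr rfl fun z hz => ?_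
          rw [← (mem_filter.1 hz).2, prod_empDist_apply]
      _ ≤ ∑ z : Fin n → X, ∏ i, empDist x (z i) :=
          sum_le_sum_of_subset_of_nonneg (filter_subset _ _)
            fun z _ _ => prod_nonneg fun i _ => empDist_nonneg x _
      _ = (∑ a, empDist x a) ^ n := by
          rw [← Fintype.piFinset_univ, ← prod_univ_sum]
          simp
      _ ≤ 1 := pow_le_one₀ (sum_nonneg fun a _ => empDist_nonneg x a) (sum_empDist_le_one x)
  rwa [Real.exp_neg, ← div_eq_mul_inv, div_le_one (Real.exp_pos _)] at h

/-- There are at most `(n + 1) ^ |X|` types of denominator `n`. -/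
theorem card_image_empDist_le {X : Type*} [Fintype X] {n : ℕ} (s : Finset (Fin n → X)) :
    (s.image empDist).card ≤ (n + 1) ^ Fintype.card X := by
  have hsub : s.image empDist ⊆ (univ : Finset (X → Fin (n + 1))).image
      (fun c a => ((c a : ℕ) : ℝ) / n) := by
    intro p hp
    obtain ⟨x, -, rfl⟩ := mem_image.1 hp
    refine mem_image.2 ⟨fun a => ⟨(univ.filter fun i => x i = a).card,
      Nat.lt_succ_of_le ((card_le_univ _).trans_eq (by simp))⟩, mem_univ _, rfl⟩
  calc _ ≤ _ := card_le_card hsub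
    _ ≤ _ := card_image_le
    _ = _ := by simp

theorem sum_mul_card_joint_eq {X Y : Type*} [Fintype X] [Fintype Y] {n m : ℕ} {Ω : Type*}
    [Fintype Ω] (μ : Ω → ℝ) (F : Ω → (Fin n → X) → (Fin m → Y)) (x : Fin n → X) (y : Fin m → Y) :
    ∑ ω, μ ω * ((univ.filter fun z : Fin n → X =>
        empDist z = empDist x ∧ empDist (F ω z) = empDist y).card : ℝ) =
      alphaE μ F (empDist x) (empDist y) *
        ((univ.filter fun z : Fin n → X => empDist z = empDist x).card : ℝ) *
        ((univ.filter fun z : Fin m → Y => empDist z = empDist y).card : ℝ) /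
          (Fintype.card Y : ℝ) ^ m := by
  have hx : 0 < (univ.filter fun z : Fin n → X => empDist z = empDist x).card :=
    card_pos.2 ⟨x, by simp⟩
  have hy : 0 < (univ.filter fun z : Fin m → Y => empDist z = empDist y).card :=
    card_pos.2 ⟨y, by simp⟩
  have hX : 0 < Fintype.card X ^ n := by
    have := Fintype.card_pos_iff.2 ⟨x⟩
    simpa using this
  have hY : 0 < Fintype.card Y ^ m := by
    have := Fintype.card_pos_iff.2 ⟨y⟩
    simpa using this
  have hX' : (0 : ℝ) < (Fintype.card X : ℝ) ^ n := by exact_mod_cast hX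
  have hY' : (0 : ℝ) < (Fintype.card Y : ℝ) ^ m := by exact_mod_cast hY
  simp only [alphaE, fullJointSpec, specS, jointSpec, card_univ, Fintype.card_pi_const,
    Nat.cast_pow, ← mul_div_assoc]
  rw [← sum_div]
  field_simp

theorem sum_card_typeClass {Y : Type*} [Fintype Y] (m : ℕ) :
    ∑ q ∈ (univ : Finset (Fin m → Y)).image empDist,
      ((univ.filter fun z : Fin m → Y => empDist z = q).card : ℝ) =
        (Fintype.card Y : ℝ) ^ m := by
  have h := card_eq_sum_card_fiberwise (s := (univ : Finset (Fin m → Y)))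
    (t := univ.image empDist) (f := empDist) (fun z _ => mem_coe.2 (mem_image_of_mem _ (mem_univ z)))
  rw [card_univ, Fintype.card_pi_const] at h
  exact_mod_cast h.symm

theorem exists_one_le_alphaE {X Y : Type*} [Fintype X] [Fintype Y] {n m : ℕ} {Ω : Type*}
    [Fintype Ω] (μ : Ω → ℝ) (hμ : ∑ ω, μ ω = 1) (F : Ω → (Fin n → X) → (Fin m → Y))
    (x : Fin n → X) [Nonempty Y] :
    ∃ y : Fin m → Y, 1 ≤ alphaE μ F (empDist x) (empDist y) := by
  by_contra! hlt
  have hx : (0 : ℝ) < (univ.filter fun z : Fin n → X => empDist z = empDist x).card := by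
    exact_mod_cast card_pos.2 ⟨x, by simp⟩
  have hY : (0 : ℝ) < (Fintype.card Y : ℝ) ^ m := by
    have := Fintype.card_pos (α := Y)
    positivity
  have hsum : ∑ q ∈ (univ : Finset (Fin m → Y)).image empDist, ∑ ω, μ ω *
      ((univ.filter fun z : Fin n → X =>
        empDist z = empDist x ∧ empDist (F ω z) = q).card : ℝ) =
      (univ.filter fun z : Fin n → X => empDist z = empDist x).card := by
    rw [sum_comm]
    simp_rw [← mul_sum]
    have h (ω : Ω) : ∑ q ∈ (univ : Finset (Fin m → Y)).image empDist,
        ((univ.filter fun z : Fin n → X =>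
          empDist z = empDist x ∧ empDist (F ω z) = q).card : ℝ) =
        (univ.filter fun z : Fin n → X => empDist z = empDist x).card := by
      have h := card_eq_sum_card_fiberwise
        (s := univ.filter fun z : Fin n → X => empDist z = empDist x)
        (t := (univ : Finset (Fin m → Y)).image empDist) (f := fun z => empDist (F ω z))
        (fun z _ => by simp)
      simp only [filter_filter] at h
      exact_mod_cast h.symm
    simp_rw [h]
    rw [← sum_mul, hμ, one_mul]
  refine hsum.not_lt ?_
  calc _ < ∑ q ∈ (univ : Finset (Fin m → Y)).image empDist,
        ((univ.filter fun z : Fin n → X => empDist z = empDist x).card : ℝ) *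
        ((univ.filter fun z : Fin m → Y => empDist z = q).card : ℝ) /
          (Fintype.card Y : ℝ) ^ m := by
        refine sum_lt_sum_of_nonempty (univ_nonempty.image _) fun q hq => ?_
        obtain ⟨y, -, rfl⟩ := mem_image.1 hq
        rw [sum_mul_card_joint_eq]
        have hy : (0 : ℝ) < (univ.filter fun z : Fin m → Y => empDist z = empDist y).card := by
          exact_mod_cast card_pos.2 ⟨y, by simp⟩
        gcongr
        exact mul_lt_of_lt_one_left hx (hlt y)
    _ = _ := by
        rw [← sum_div, ← mul_sum, sum_card_typeClass]
        field_simp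

/-- The expected number of graph points of low entropy, in terms of a bound on `alphaE`. -/
theorem expected_card_le {X Y : Type*} [Fintype X] [Fintype Y] [Zero X] {n m : ℕ} {Ω : Type*}
    [Fintype Ω] (μ : Ω → ℝ) (hμ : ∀ ω, 0 ≤ μ ω) (F : Ω → (Fin n → X) → (Fin m → Y))
    {A : ℝ} (hA : 0 ≤ A)
    (hα : ∀ x : Fin n → X, x ≠ 0 → ∀ y : Fin m → Y,
      alphaE μ F (empDist x) (empDist y) ≤ A) (hX hY : ℝ) :
    ∑ ω, μ ω * ((univ.filter fun x : Fin n → X => x ≠ 0 ∧ entH (empDist x) ≤ hX ∧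
        entH (empDist (F ω x)) ≤ hY).card : ℝ) ≤
      (n + 1 : ℝ) ^ Fintype.card X * ((m + 1 : ℝ) ^ Fintype.card Y *
        (A * Real.exp (n * hX) * Real.exp (m * hY) / (Fintype.card Y : ℝ) ^ m)) := by
  set S : Finset (X → ℝ) := (univ.filter fun x : Fin n → X =>
    x ≠ 0 ∧ entH (empDist x) ≤ hX).image empDist with hS
  set T : Finset (Y → ℝ) := (univ.filter fun y : Fin m → Y =>
    entH (empDist y) ≤ hY).image empDist with hT
  have hcount (ω : Ω) : ((univ.filter fun x : Fin n → X => x ≠ 0 ∧ entH (empDist x) ≤ hX ∧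
        entH (empDist (F ω x)) ≤ hY).card : ℝ) ≤ ∑ p ∈ S, ∑ q ∈ T,
        ((univ.filter fun z : Fin n → X => empDist z = p ∧ empDist (F ω z) = q).card : ℝ) := by
    rw [← sum_product']
    have h := card_eq_sum_card_fiberwise
      (s := univ.filter fun x : Fin n → X => x ≠ 0 ∧ entH (empDist x) ≤ hX ∧
        entH (empDist (F ω x)) ≤ hY)
      (t := S ×ˢ T) (f := fun z => (empDist z, empDist (F ω z))) (fun z hz => by
        simp only [coe_filter, mem_univ, true_and, Set.mem_ofPred_eq] at hz
        exact mem_product.2 ⟨mem_image.2 ⟨z, by simp [hz], rfl⟩,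
          mem_image.2 ⟨F ω z, by simp [hz], rfl⟩⟩)
    rw [h]
    push_cast
    refine sum_le_sum fun pq _ => ?_
    refine Nat.cast_le.2 (card_le_card fun z hz => ?_)
    simp only [mem_filter, Prod.ext_iff] at hz
    simp [hz.2]
  have hterm : ∀ p ∈ S, ∀ q ∈ T, ∑ ω, μ ω * ((univ.filter fun z : Fin n → X =>
      empDist z = p ∧ empDist (F ω z) = q).card : ℝ) ≤
      A * Real.exp (n * hX) * Real.exp (m * hY) / (Fintype.card Y : ℝ) ^ m := by
    intro p hp q hq
    obtain ⟨x, hx, rfl⟩ := mem_image.1 hp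
    obtain ⟨y, hy, rfl⟩ := mem_image.1 hq
    simp only [mem_filter, mem_univ, true_and] at hx hy
    rw [sum_mul_card_joint_eq]
    have h1 : ((univ.filter fun z : Fin n → X => empDist z = empDist x).card : ℝ) ≤
        Real.exp (n * hX) := (card_typeClass_le x).trans (by gcongr; exact hx.2)
    have h2 : ((univ.filter fun z : Fin m → Y => empDist z = empDist y).card : ℝ) ≤
        Real.exp (m * hY) := (card_typeClass_le y).trans (by gcongr)
    have h3 := hα x hx.1 y
    gcongr
  have hcS : (S.card : ℝ) ≤ (n + 1 : ℝ) ^ Fintype.card X := by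
    exact_mod_cast card_image_empDist_le _
  have hcT : (T.card : ℝ) ≤ (m + 1 : ℝ) ^ Fintype.card Y := by
    exact_mod_cast card_image_empDist_le _
  calc _ ≤ ∑ ω, μ ω * ∑ p ∈ S, ∑ q ∈ T,
        ((univ.filter fun z : Fin n → X => empDist z = p ∧ empDist (F ω z) = q).card : ℝ) :=
        sum_le_sum fun ω _ => mul_le_mul_of_nonneg_left (hcount ω) (hμ ω)
    _ = ∑ p ∈ S, ∑ q ∈ T, ∑ ω, μ ω * ((univ.filter fun z : Fin n → X =>
          empDist z = p ∧ empDist (F ω z) = q).card : ℝ) := by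
        simp_rw [mul_sum]
        rw [sum_comm]
        exact sum_congr rfl fun p _ => sum_comm
    _ ≤ ∑ p ∈ S, ∑ q ∈ T,
          A * Real.exp (n * hX) * Real.exp (m * hY) / (Fintype.card Y : ℝ) ^ m :=
        sum_le_sum fun p hp => sum_le_sum fun q hq => hterm p hp q hq
    _ = S.card * (T.card *
          (A * Real.exp (n * hX) * Real.exp (m * hY) / (Fintype.card Y : ℝ) ^ m)) := by
        simp only [sum_const, nsmul_eq_mul]
    _ ≤ _ := by gcongr

theorem eventually_add_one_pow_le_exp (k : ℕ) {ε : ℝ} (hε : 0 < ε) :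
    ∀ᶠ n : ℕ in atTop, (n + 1 : ℝ) ^ k ≤ Real.exp (n * ε) := by
  have h := (isLittleO_pow_exp_pos_mul_atTop k hε).def (Real.exp_pos (-ε))
  have ht : Tendsto (fun n : ℕ => (n : ℝ) + 1) atTop atTop :=
    tendsto_natCast_atTop_atTop.atTop_add tendsto_const_nhds
  filter_upwards [ht.eventually h] with n hn
  rw [Real.norm_of_nonneg (by positivity), Real.norm_of_nonneg (Real.exp_pos _).le,
    ← Real.exp_add] at hn
  exact hn.trans_eq (by ring_nf)

theorem stmt14 {X Y : Type*} [Fintype X] [Fintype Y] [AddCommGroup X] [AddCommGroup Y]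
    (m : ℕ → ℕ) (hm : ∀ n, 0 < m n)
    (Ω : ℕ → Type*) [∀ n, Fintype (Ω n)] (μ : ∀ n, Ω n → ℝ)
    (hμ0 : ∀ n ω, 0 ≤ μ n ω) (hμ1 : ∀ n, ∑ ω, μ n ω = 1)
    (F : ∀ n, Ω n → ((Fin n → X) →+ (Fin (m n) → Y)))
    (δ Rbar : ℝ)
    (hδ : ∀ ε > (0 : ℝ), ∀ᶠ n : ℕ in atTop, ∀ x : Fin n → X, x ≠ 0 → ∀ y : Fin (m n) → Y,
      alphaE (μ n) (fun ω => ⇑(F n ω)) (empDist x) (empDist y) ≤ Real.exp (n * (δ + ε)))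
    (hR : ∀ ε > (0 : ℝ), ∀ᶠ n : ℕ in atTop, (n : ℝ) / (m n : ℝ) ≤ Rbar + ε)
    (hX hY : ℝ)
    (hcond : (hX + δ) * Rbar + hY < Real.log (Fintype.card Y)) :
    Tendsto (fun n => ∑ ω, μ n ω *
        ((univ.filter fun x : Fin n → X => x ≠ 0 ∧ entH (empDist x) ≤ hX ∧
            entH (empDist (F n ω x)) ≤ hY).card : ℝ))
      atTop (nhds 0) := by
  have : Nonempty Y := ⟨0⟩
  rcases lt_or_ge hX 0 with hX0 | hX0
  · refine tendsto_const_nhds.congr fun n => (sum_eq_zero fun ω _ => ?_).symm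
    rw [filter_false_of_mem fun x _ h => ?_, card_empty, Nat.cast_zero, mul_zero]
    linarith [entH_empDist_nonneg x, h.2.1]
  rcases subsingleton_or_nontrivial X with hsub | hnt
  · refine tendsto_const_nhds.congr fun n => (sum_eq_zero fun ω _ => ?_).symm
    rw [filter_false_of_mem fun x _ h => h.1 (Subsingleton.elim _ _), card_empty, Nat.cast_zero,
      mul_zero]
  have hδ0 : 0 ≤ δ := by
    refine le_of_forall_pos_le_add fun ε hε => ?_
    obtain ⟨n, hn, hn0⟩ := ((hδ ε hε).and (eventually_gt_atTop 0)).exists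
    have : Nonempty (Fin n) := ⟨⟨0, hn0⟩⟩
    obtain ⟨x, hx⟩ := exists_ne (0 : Fin n → X)
    obtain ⟨y, hy⟩ := exists_one_le_alphaE (μ n) (hμ1 n) (fun ω => ⇑(F n ω)) x
    have h := Real.one_le_exp_iff.1 (hy.trans (hn x hx y))
    exact nonneg_of_mul_nonneg_right h (by exact_mod_cast hn0)
  obtain ⟨ε, hε, hlt⟩ : ∃ ε > (0 : ℝ), (hX + δ + 2 * ε) * (Rbar + ε) + hY + 2 * ε <
      Real.log (Fintype.card Y) := by
    have hc : Tendsto (fun ε : ℝ => (hX + δ + 2 * ε) * (Rbar + ε) + hY + 2 * ε) (nhds 0)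
        (nhds ((hX + δ) * Rbar + hY)) := by
      have : Continuous (fun ε : ℝ => (hX + δ + 2 * ε) * (Rbar + ε) + hY + 2 * ε) := by fun_prop
      simpa using this.tendsto 0
    have h : ∀ᶠ ε in nhdsWithin (0 : ℝ) (Set.Ioi 0), _ :=
      (hc.mono_left nhdsWithin_le_nhds).eventually_lt_const hcond
    obtain ⟨ε, h1, h2⟩ := (h.and self_mem_nhdsWithin).exists
    exact ⟨ε, h2, h1⟩
  have hm_top : Tendsto m atTop atTop := by
    rw [← tendsto_natCast_atTop_iff (R := ℝ)]
    have hR' : ∀ᶠ n : ℕ in atTop, (n : ℝ) * (|Rbar + 1| + 1)⁻¹ ≤ m n := by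
      filter_upwards [hR 1 one_pos] with n hn
      have hmn : (0 : ℝ) < m n := by exact_mod_cast hm n
      rw [← div_eq_mul_inv, div_le_iff₀ (by positivity)]
      rw [div_le_iff₀ hmn] at hn
      nlinarith [le_abs_self (Rbar + 1)]
    exact tendsto_atTop_mono' _ hR' (tendsto_natCast_atTop_atTop.atTop_mul_const (by positivity))
  have hlim : Tendsto (fun n => Real.exp (-((m n : ℝ) * ε))) atTop (nhds 0) :=
    Real.tendsto_exp_neg_atTop_nhds_zero.comp
      ((tendsto_natCast_atTop_atTop.comp hm_top).atTop_mul_const hε)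
  refine squeeze_zero' (Eventually.of_forall fun n => sum_nonneg fun ω _ =>
    mul_nonneg (hμ0 n ω) (Nat.cast_nonneg _)) ?_ hlim
  filter_upwards [hδ ε hε, hR ε hε, eventually_add_one_pow_le_exp (Fintype.card X) hε,
    hm_top.eventually (eventually_add_one_pow_le_exp (Fintype.card Y) hε)] with n h1 h2 h3 h4
  refine (expected_card_le (μ n) (hμ0 n) (fun ω => ⇑(F n ω)) (Real.exp_pos _).le h1 hX hY).trans ?_
  have hmn : (0 : ℝ) < m n := by exact_mod_cast hm n
  have hYpow : (Fintype.card Y : ℝ) ^ m n = Real.exp (m n * Real.log (Fintype.card Y)) := by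
    rw [Real.exp_nat_mul, Real.exp_log (by exact_mod_cast Fintype.card_pos)]
  calc _ ≤ Real.exp (n * ε) * (Real.exp (m n * ε) * (Real.exp (n * (δ + ε)) * Real.exp (n * hX) *
        Real.exp (m n * hY) / (Fintype.card Y : ℝ) ^ m n)) := by gcongr
    _ = Real.exp (n * (hX + δ + 2 * ε) + m n * (hY + ε - Real.log (Fintype.card Y))) := by
        rw [hYpow, ← Real.exp_add, ← Real.exp_add, ← Real.exp_sub, ← Real.exp_add, ← Real.exp_add]
        ring_nf
    _ ≤ _ := by
        rw [Real.exp_le_exp]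
        rw [div_le_iff₀ hmn] at h2
        have h5 := mul_le_mul_of_nonneg_right h2 (by positivity : 0 ≤ hX + δ + 2 * ε)
        nlinarith [mul_lt_mul_of_pos_left hlt hmn]
end
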